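/- arXiv:1412.5976 — 2 statements merged into one kernel-verified Lean document; each statement's English description precedes it below -/
import Mathlib

section
/- Let L be a first-order language whose symbol sets are encodable and T a complete, decidable L-theory. If A and B are decidable models of T (with universe ℕ) that are both effectively atomic, then there is a computable isomorphism f : A ≅ B, i.e., a computable bijection f : ℕ → ℕ that is an L-isomorphism from A to B. -/
open FirstOrder FirstOrder.Language

/-- `φ` is a complete formula for the theory `T`. -/
def IsCompleteFormula {L : FirstOrder.Language.{u, v}} (T : L.Theory) {α : Type*}
    (φ : L.Formula α) : Prop :=
  ∀ ψ : L.Formula α, Xor' (T ⊨ᵇ φ.imp ψ) (T ⊨ᵇ φ.imp ψ.not)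

section Effective

variable {L : FirstOrder.Language.{0, 0}}
  [∀ k, Encodable (L.Functions k)] [∀ k, Encodable (L.Relations k)]

/-- The code of a formula `φ` with free variables among `x₀, …, x_{n-1}`, obtained from the
standard encoding of formulas as lists of symbols, paired with the arity `n`. -/
def fmlCode {n : ℕ} (φ : L.Formula (Fin n)) : ℕ :=
  Nat.pair n (Encodable.encode φ.listEncode)

/-- The code of a sentence, via the standard encoding of formulas as lists of symbols. -/
def sentenceCode (σ : L.Sentence) : ℕ :=
  Encodable.encode σ.listEncode

/-- A theory `T` is decidable if the set of codes of sentences in `T` is computable. -/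
def IsDecidableTheory (T : L.Theory) : Prop :=
  ∃ f : ℕ → Bool, Computable f ∧ ∀ σ : L.Sentence, (f (sentenceCode σ) = true ↔ σ ∈ T)

/-- An `L`-structure on `ℕ` is decidable if there is a computable function deciding, given
the code of a formula `φ` with free variables among `x₀, …, x_{n-1}` and (the code of) a
tuple `a⃗ ∈ ℕⁿ`, whether `φ(a⃗)` holds in the structure. -/
def IsDecidableStructure (S : L.Structure ℕ) : Prop :=
  ∃ f : ℕ → ℕ → Bool, Computable₂ f ∧
    ∀ (n : ℕ) (φ : L.Formula (Fin n)) (a : Fin n → ℕ),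
      (f (fmlCode φ) (Encodable.encode (List.ofFn a)) = true ↔
        letI := S; φ.Realize a)

/-- The structure `S` on `ℕ` is a model of the theory `T`. -/
def StructureModels (S : L.Structure ℕ) (T : L.Theory) : Prop :=
  letI := S; ℕ ⊨ T

/-- `f : ℕ → ℕ` is an elementary embedding from the structure `SA` to the structure `SM`. -/
def IsElementaryMap (SA SM : L.Structure ℕ) (f : ℕ → ℕ) : Prop :=
  ∀ (n : ℕ) (φ : L.Formula (Fin n)) (a : Fin n → ℕ),
    (letI := SM; φ.Realize (f ∘ a)) ↔ (letI := SA; φ.Realize a)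

/-- `f : ℕ → ℕ` is an isomorphism from the structure `SA` to the structure `SB`. -/
def IsIsomorphismMap (SA SB : L.Structure ℕ) (f : ℕ → ℕ) : Prop :=
  Function.Bijective f ∧
    (∀ (n : ℕ) (F : L.Functions n) (a : Fin n → ℕ),
      f (SA.funMap F a) = SB.funMap F (f ∘ a)) ∧
    (∀ (n : ℕ) (R : L.Relations n) (a : Fin n → ℕ),
      (SB.RelMap R (f ∘ a) ↔ SA.RelMap R a))

/-- A decidable model `S` of `T` is effectively atomic if there is a computable function
which, given (the code of) any finite tuple from the model, outputs the code of a complete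
formula for `T` satisfied by that tuple. -/
def IsEffectivelyAtomic (T : L.Theory) (S : L.Structure ℕ) : Prop :=
  ∃ g : ℕ → ℕ, Computable g ∧
    ∀ l : List ℕ, ∃ φ : L.Formula (Fin l.length),
      g (Encodable.encode l) = fmlCode φ ∧ IsCompleteFormula T φ ∧
        (letI := S; φ.Realize l.get)

/-- A decidable model `SA` of `T` is effectively prime if for every decidable model of `T`
(with universe `ℕ`) there is a computable elementary embedding of `SA` into it. -/
def IsEffectivelyPrime (T : L.Theory) (SA : L.Structure ℕ) : Prop :=
  ∀ SM : L.Structure ℕ, IsDecidableStructure SM → StructureModels SM T →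
    ∃ f : ℕ → ℕ, Computable f ∧ IsElementaryMap SA SM f

end Effective

section BackAndForth

variable {L : FirstOrder.Language.{0, 0}}

/-- The relation `R` between `M` and `N` preserves the truth of all first-order formulas. -/
def IsPartialElementary (L : FirstOrder.Language.{0, 0}) (M N : Type) [L.Structure M]
    [L.Structure N] (R : Set (M × N)) : Prop :=
  ∀ (n : ℕ) (φ : L.Formula (Fin n)) (p : Fin n → M × N), (∀ i, p i ∈ R) →
    (φ.Realize (fun i => (p i).1) ↔ φ.Realize (fun i => (p i).2))

section General

variable {M N : Type} [L.Structure M] [L.Structure N]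

theorem IsPartialElementary.swap {R : Set (M × N)} (h : IsPartialElementary L M N R) :
    IsPartialElementary L N M (Prod.swap ⁻¹' R) :=
  fun n φ p hp => (h n φ (fun i => (p i).swap) hp).symm

theorem isPartialElementary_empty {T : L.Theory} (hT : T.IsComplete) [Nonempty M] [Nonempty N]
    [M ⊨ T] [N ⊨ T] : IsPartialElementary L M N ∅ := by
  intro n φ p hp
  have : IsEmpty (Fin n) := ⟨fun i => hp i⟩
  let σ : L.Sentence := φ.relabel (fun i : Fin n => (isEmptyElim i : Empty))
  have h := (hT.realize_sentence_iff σ M).trans (hT.realize_sentence_iff σ N).symm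
  simp only [σ, Sentence.Realize, Formula.realize_relabel] at h
  convert h

theorem IsPartialElementary.iUnion {s : ℕ → Set (M × N)} (hs : Monotone s)
    (h : ∀ k, IsPartialElementary L M N (s k)) : IsPartialElementary L M N (⋃ k, s k) := by
  intro n φ p hp
  simp only [Set.mem_iUnion] at hp
  choose k hk using hp
  exact h (Finset.univ.sup k) n φ p fun i => hs (Finset.le_sup (Finset.mem_univ i)) (hk i)

theorem IsPartialElementary.eq_iff {R : Set (M × N)} (h : IsPartialElementary L M N R)
    {a a' : M} {b b' : N} (hab : (a, b) ∈ R) (hab' : (a', b') ∈ R) : a = a' ↔ b = b' := by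
  have := h 2 ((Term.var 0).equal (Term.var 1)) ![(a, b), (a', b')] (by simp [Fin.forall_fin_two, *])
  simpa [Formula.realize_equal] using this

theorem IsPartialElementary.map_funMap {f : M → N}
    (h : IsPartialElementary L M N {p | p.2 = f p.1}) {n : ℕ} (F : L.Functions n) (a : Fin n → M) :
    f (Structure.funMap F a) = Structure.funMap F (f ∘ a) := by
  have := h (n + 1) (Formula.graph F)
    (fun i => ((Fin.cons (Structure.funMap F a) a : Fin (n + 1) → M) i,
      f ((Fin.cons (Structure.funMap F a) a : Fin (n + 1) → M) i))) (fun i => rfl)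
  have hcons : (fun i => f ((Fin.cons (Structure.funMap F a) a : Fin (n + 1) → M) i)) =
      Fin.cons (f (Structure.funMap F a)) (f ∘ a) := by
    funext i
    refine Fin.cases ?_ (fun j => ?_) i <;> simp
  rw [hcons, Formula.realize_graph, Formula.realize_graph] at this
  exact (this.1 rfl).symm

theorem IsPartialElementary.relMap_iff {f : M → N}
    (h : IsPartialElementary L M N {p | p.2 = f p.1}) {n : ℕ} (R : L.Relations n) (a : Fin n → M) :
    Structure.RelMap R (f ∘ a) ↔ Structure.RelMap R a := by
  have := h n (R.formula Term.var) (fun i => (a i, f (a i))) (fun i => rfl)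
  simpa [Formula.realize_rel, Function.comp_def] using this.symm

theorem IsPartialElementary.exists_realize_cons {P : List (M × N)}
    (h : IsPartialElementary L M N {p | p ∈ P}) {a : M} (φ : L.Formula (Fin (P.length + 1)))
    (hφ : φ.Realize (Fin.cons a fun i => (P.get i).1 : Fin (P.length + 1) → M)) :
    ∃ b : N, φ.Realize (Fin.cons b fun i => (P.get i).2 : Fin (P.length + 1) → N) := by
  let g : Fin (P.length + 1) → Fin P.length ⊕ Fin 1 := Fin.cons (Sum.inr 0) Sum.inl
  have hg : ∀ {K : Type} (c : Fin 1 → K) (u : Fin P.length → K),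
      Sum.elim u c ∘ g = Fin.cons (c 0) u := by
    intro K c u
    funext i
    refine Fin.cases ?_ (fun j => ?_) i <;> simp [g]
  have key := h _ ((φ.relabel g).iExs (Fin 1)) P.get (fun i => P.get_mem i)
  simp only [Formula.realize_iExs, Formula.realize_relabel, hg] at key
  obtain ⟨c, hc⟩ := key.1 ⟨fun _ => a, hφ⟩
  exact ⟨c 0, hc⟩

theorem IsCompleteFormula.realize_imp {T : L.Theory} [Nonempty M] [Nonempty N] [M ⊨ T] [N ⊨ T]
    {α : Type} {φ : L.Formula α} (hφ : IsCompleteFormula T φ) {u : α → M} {v : α → N}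
    (hu : φ.Realize u) (hv : φ.Realize v) {ψ : L.Formula α} (hψ : ψ.Realize u) :
    ψ.Realize v := by
  rcases hφ ψ with ⟨h, -⟩ | ⟨h, -⟩
  · exact Formula.realize_imp.1 (h.realize_formula N) hv
  · exact absurd hψ (Formula.realize_not.1 (Formula.realize_imp.1 (h.realize_formula M) hu))

theorem IsCompleteFormula.isPartialElementary {T : L.Theory} [Nonempty M] [Nonempty N]
    [M ⊨ T] [N ⊨ T] {P : List (M × N)} {φ : L.Formula (Fin P.length)}
    (hφ : IsCompleteFormula T φ) (hM : φ.Realize fun i => (P.get i).1)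
    (hN : φ.Realize fun i => (P.get i).2) : IsPartialElementary L M N {p | p ∈ P} := by
  intro n ψ p hp
  choose j hj using fun i => List.mem_iff_get.1 (hp i)
  have hψ := Iff.intro
    (hφ.realize_imp hM hN (ψ := ψ.relabel j)) (hφ.realize_imp hN hM (ψ := ψ.relabel j))
  simpa only [Formula.realize_relabel, Function.comp_def, hj] using hψ

end General

/-- A back-and-forth construction whose two extension steps are partial recursive produces a
computable function that preserves all formulas. -/
theorem exists_computable_bijective_isPartialElementary {SA SB : L.Structure ℕ}
    {forth back : ℕ → List (ℕ × ℕ) →. ℕ} (hforth : Partrec₂ forth) (hback : Partrec₂ back)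
    (h0 : @IsPartialElementary L ℕ ℕ SA SB ∅)
    (hf : ∀ a P, @IsPartialElementary L ℕ ℕ SA SB {p | p ∈ P} →
      ∃ b ∈ forth a P, @IsPartialElementary L ℕ ℕ SA SB {p | p ∈ (a, b) :: P})
    (hb : ∀ b P, @IsPartialElementary L ℕ ℕ SA SB {p | p ∈ P} →
      ∃ a ∈ back b P, @IsPartialElementary L ℕ ℕ SA SB {p | p ∈ (a, b) :: P}) :
    ∃ f : ℕ → ℕ, Computable f ∧ Function.Bijective f ∧
      @IsPartialElementary L ℕ ℕ SA SB {p | p.2 = f p.1} := by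
  choose F hF hFE using hf
  choose B hB hBE using hb
  let s : ℕ → {P : List (ℕ × ℕ) // @IsPartialElementary L ℕ ℕ SA SB {p | p ∈ P}} := fun k =>
    Nat.rec ⟨[], by simpa using h0⟩
      (fun k P => ⟨(B k _ (hFE k P.1 P.2), k) :: (k, F k P.1 P.2) :: P.1, hBE k _ _⟩) k
  have hs : Computable fun k => (s k).1 := by
    have hcons : Computable₂ fun (y : (ℕ × List (ℕ × ℕ))) (b : ℕ) => (y.1, b) :: y.2 :=
      Computable.list_cons.comp
        ((Computable.fst.comp Computable.fst).pair Computable.snd)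
        (Computable.snd.comp Computable.fst)
    have hcons' : Computable₂ fun (y : (ℕ × List (ℕ × ℕ))) (a : ℕ) => (a, y.1) :: y.2 :=
      Computable.list_cons.comp
        (Computable.snd.pair (Computable.fst.comp Computable.fst))
        (Computable.snd.comp Computable.fst)
    have hstepF : Partrec fun y : ℕ × List (ℕ × ℕ) =>
        (forth y.1 y.2).map fun b => (y.1, b) :: y.2 := Partrec.map hforth hcons
    have hstepB : Partrec fun y : ℕ × List (ℕ × ℕ) =>
        (back y.1 y.2).map fun a => (a, y.1) :: y.2 := Partrec.map hback hcons'
    have hstep : Partrec fun y : ℕ × List (ℕ × ℕ) =>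
        ((forth y.1 y.2).map fun b => (y.1, b) :: y.2).bind fun Q =>
          (back y.1 Q).map fun a => (a, y.1) :: Q :=
      hstepF.bind (hstepB.comp ((Computable.fst.comp Computable.fst).pair Computable.snd)).to₂
    have hrec := Partrec.nat_rec (f := fun k : ℕ => k) Computable.id
      (Computable.const ([] : List (ℕ × ℕ))).partrec (hstep.comp Computable.snd).to₂
    refine hrec.of_eq_tot fun k => ?_
    induction k with
    | zero => exact Part.mem_some _
    | succ k ih =>
      exact Part.mem_bind ih (Part.mem_bind (Part.mem_map _ (hF k (s k).1 (s k).2))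
        (Part.mem_map _ (hB k _ (hFE k (s k).1 (s k).2))))
  let f : ℕ → ℕ := fun k => F k (s k).1 (s k).2
  have hmono : Monotone fun k => {p | p ∈ (s k).1} :=
    monotone_nat_of_le_succ fun k p hp => List.mem_cons_of_mem _ (List.mem_cons_of_mem _ hp)
  have hR := @IsPartialElementary.iUnion L ℕ ℕ SA SB _ hmono fun k => (s k).2
  set R : Set (ℕ × ℕ) := ⋃ k, {p | p ∈ (s k).1}
  have hfR : ∀ a, (a, f a) ∈ R := fun a => Set.mem_iUnion.2
    ⟨a + 1, List.mem_cons_of_mem _ List.mem_cons_self⟩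
  have hbR : ∀ b, ∃ a, (a, b) ∈ R := fun b =>
    ⟨B b _ (hFE b (s b).1 (s b).2), Set.mem_iUnion.2 ⟨b + 1, List.mem_cons_self⟩⟩
  refine ⟨f, ?_, ⟨fun a a' h => ?_, fun b => ?_⟩, fun n φ p hp => hR n φ p fun i => ?_⟩
  · exact (hforth.comp Computable.id hs).of_eq_tot fun k => hF k (s k).1 (s k).2
  · exact (@IsPartialElementary.eq_iff L ℕ ℕ SA SB R hR _ _ _ _ (hfR a) (hfR a')).2 h
  · obtain ⟨a, ha⟩ := hbR b
    exact ⟨a, (@IsPartialElementary.eq_iff L ℕ ℕ SA SB R hR _ _ _ _ (hfR a) ha).1 rfl⟩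
  · have h : (p i).2 = f (p i).1 := hp i
    have := hfR (p i).1
    rwa [← h] at this

variable [∀ k, Encodable (L.Functions k)] [∀ k, Encodable (L.Relations k)]

/-- Search for an element `b` such that the decision procedure `f` accepts the formula produced by
`g` from `a` and the first components of `P`, at `b` and the second components of `P`. -/
def searchPartner (g : ℕ → ℕ) (f : ℕ → ℕ → Bool) (a : ℕ) (P : List (ℕ × ℕ)) : Part ℕ :=
  Nat.rfind fun b => Part.some
    (f (g (Encodable.encode (a :: P.map Prod.fst))) (Encodable.encode (b :: P.map Prod.snd)))

theorem searchPartner_partrec {g : ℕ → ℕ} {f : ℕ → ℕ → Bool} (hg : Computable g)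
    (hf : Computable₂ f) : Partrec₂ (searchPartner g f) := by
  have hmap : ∀ {q : ℕ × ℕ → ℕ}, Primrec q → Primrec fun P : List (ℕ × ℕ) => P.map q :=
    fun hq => Primrec.list_map Primrec.id (hq.comp Primrec.snd).to₂
  refine Partrec.rfind (p := fun (x : ℕ × List (ℕ × ℕ)) (b : ℕ) => Part.some
    (f (g (Encodable.encode (x.1 :: x.2.map Prod.fst)))
      (Encodable.encode (b :: x.2.map Prod.snd)))) ?_
  have h1 : Primrec fun y : (ℕ × List (ℕ × ℕ)) × ℕ =>
      Encodable.encode (y.1.1 :: y.1.2.map Prod.fst) :=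
    Primrec.encode.comp (Primrec.list_cons.comp (Primrec.fst.comp Primrec.fst)
      ((hmap Primrec.fst).comp (Primrec.snd.comp Primrec.fst)))
  have h2 : Primrec fun y : (ℕ × List (ℕ × ℕ)) × ℕ =>
      Encodable.encode (y.2 :: y.1.2.map Prod.snd) :=
    Primrec.encode.comp (Primrec.list_cons.comp Primrec.snd
      ((hmap Primrec.snd).comp (Primrec.snd.comp Primrec.fst)))
  exact (hf.comp (hg.comp h1.to_comp) h2.to_comp).partrec

theorem exists_mem_searchPartner {T : L.Theory} {SA SB : L.Structure ℕ}
    (hA : StructureModels SA T) (hB : StructureModels SB T) {g : ℕ → ℕ}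
    (hg : ∀ l : List ℕ, ∃ φ : L.Formula (Fin l.length),
      g (Encodable.encode l) = fmlCode φ ∧ IsCompleteFormula T φ ∧ (letI := SA; φ.Realize l.get))
    {f : ℕ → ℕ → Bool}
    (hf : ∀ (n : ℕ) (φ : L.Formula (Fin n)) (a : Fin n → ℕ),
      (f (fmlCode φ) (Encodable.encode (List.ofFn a)) = true ↔ letI := SB; φ.Realize a))
    (a : ℕ) (P : List (ℕ × ℕ)) (hP : @IsPartialElementary L ℕ ℕ SA SB {p | p ∈ P}) :
    ∃ b ∈ searchPartner g f a P, @IsPartialElementary L ℕ ℕ SA SB {p | p ∈ (a, b) :: P} := by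
  have hg' : ∀ (n : ℕ) (u : Fin n → ℕ), ∃ φ : L.Formula (Fin n),
      g (Encodable.encode (List.ofFn u)) = fmlCode φ ∧ IsCompleteFormula T φ ∧
        (letI := SA; φ.Realize u) := by
    intro n u
    have key : ∀ (l : List ℕ) (h : l.length = n), (∀ i : Fin n, l.get (i.cast h.symm) = u i) →
        ∃ φ : L.Formula (Fin n), g (Encodable.encode l) = fmlCode φ ∧ IsCompleteFormula T φ ∧
          (letI := SA; φ.Realize u) := by
      rintro l rfl hu
      obtain rfl : l.get = u := funext hu
      exact hg l
    exact key _ (List.length_ofFn) (by simp)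
  have hcons : ∀ (c : ℕ) (q : ℕ × ℕ → ℕ), c :: P.map q =
      List.ofFn (Fin.cons c fun i => q (P.get i) : Fin (P.length + 1) → ℕ) := by
    intro c q
    rw [List.ofFn_succ]
    simp only [Fin.cons_zero, Fin.cons_succ]
    conv_lhs => rw [← List.ofFn_get P, List.map_ofFn]
    rfl
  obtain ⟨φ, hgφ, hφ, hφA⟩ := hg' _ (Fin.cons a fun i => (P.get i).1 : Fin (P.length + 1) → ℕ)
  have hdec : ∀ b, f (g (Encodable.encode (a :: P.map Prod.fst)))
      (Encodable.encode (b :: P.map Prod.snd)) = true ↔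
      @Formula.Realize L ℕ SB _ φ (Fin.cons b fun i => (P.get i).2 : Fin (P.length + 1) → ℕ) := by
    intro b
    rw [hcons, hcons, hgφ]
    exact hf _ _ _
  obtain ⟨c, hc⟩ := @IsPartialElementary.exists_realize_cons L ℕ ℕ SA SB P hP a φ hφA
  obtain ⟨b, hb, -⟩ := Nat.rfind_min' (p := fun b => f (g (Encodable.encode (a :: P.map Prod.fst)))
    (Encodable.encode (b :: P.map Prod.snd))) ((hdec c).2 hc)
  have hb' := (hdec b).1 (Part.mem_some_iff.1 (Nat.rfind_spec hb)).symm
  have hget : ∀ q : ℕ × ℕ → ℕ, (Fin.cons (q (a, b)) fun i => q (P.get i) :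
      Fin (P.length + 1) → ℕ) = fun i => q (((a, b) :: P).get i) := by
    intro q
    funext i
    refine Fin.cases ?_ (fun j => ?_) i <;> rfl
  refine ⟨b, hb, @IsCompleteFormula.isPartialElementary L ℕ ℕ SA SB T _ _ hA hB ((a, b) :: P) φ
    hφ ?_ ?_⟩
  · exact hget Prod.fst ▸ hφA
  · exact hget Prod.snd ▸ hb'

end BackAndForth

/-- If `A` and `B` are decidable models (with universe `ℕ`) of a complete, decidable theory
`T`, and both are effectively atomic, then there is a computable isomorphism from `A` to
`B`. -/
theorem effectively_atomic_computably_isomorphic {L : FirstOrder.Language.{0, 0}}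
    [∀ k, Encodable (L.Functions k)] [∀ k, Encodable (L.Relations k)]
    (T : L.Theory) (hT : T.IsComplete) (hTdec : IsDecidableTheory T)
    (SA SB : L.Structure ℕ)
    (hSAdec : IsDecidableStructure SA) (hSBdec : IsDecidableStructure SB)
    (hSAmod : StructureModels SA T) (hSBmod : StructureModels SB T)
    (hSAatomic : IsEffectivelyAtomic T SA) (hSBatomic : IsEffectivelyAtomic T SB) :
    ∃ f : ℕ → ℕ, Computable f ∧ IsIsomorphismMap SA SB f := by
  obtain ⟨dA, hdA, hdecA⟩ := hSAdec
  obtain ⟨dB, hdB, hdecB⟩ := hSBdec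
  obtain ⟨gA, hgA, hatA⟩ := hSAatomic
  obtain ⟨gB, hgB, hatB⟩ := hSBatomic
  have hswap : Computable fun P : List (ℕ × ℕ) => P.map Prod.swap :=
    (Primrec.list_map Primrec.id
      ((Primrec.snd.pair Primrec.fst).comp Primrec.snd).to₂).to_comp
  have hmem : ∀ (P : List (ℕ × ℕ)), Prod.swap ⁻¹' {p | p ∈ P} = {p | p ∈ P.map Prod.swap} := by
    intro P
    ext ⟨a, b⟩
    simp
  obtain ⟨f, hf, hbij, hfE⟩ := exists_computable_bijective_isPartialElementary
    (SA := SA) (SB := SB) (forth := searchPartner gA dB)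
    (back := fun b P => searchPartner gB dA b (P.map Prod.swap))
    (searchPartner_partrec hgA hdB)
    ((searchPartner_partrec hgB hdA).comp Computable.fst (hswap.comp Computable.snd))
    (@isPartialElementary_empty L ℕ ℕ SA SB T hT _ _ hSAmod hSBmod)
    (exists_mem_searchPartner hSAmod hSBmod hatA hdecB)
    (fun b P hP => by
      have hP' := @IsPartialElementary.swap L ℕ ℕ SA SB _ hP
      rw [hmem] at hP'
      obtain ⟨a, ha, haE⟩ := exists_mem_searchPartner hSBmod hSAmod hatB hdecA b _ hP'
      refine ⟨a, ha, ?_⟩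
      have h := @IsPartialElementary.swap L ℕ ℕ SB SA _ haE
      rw [hmem] at h
      simpa using h)
  exact ⟨f, hf, hbij, fun n F a => @IsPartialElementary.map_funMap L ℕ ℕ SA SB f hfE n F a,
    fun n R a => @IsPartialElementary.relMap_iff L ℕ ℕ SA SB f hfE n R a⟩
end

section
/- (Effectively Atomic ⇒ Effectively Prime) Let L be a first-order language whose symbol sets are encodable and T a complete, decidable L-theory. If A is a decidable model of T that is effectively atomic, then A is effectively prime: for every decidable model M ⊨ T there is a computable elementary embedding of A into M. -/
open FirstOrder FirstOrder.Language

section Effective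

variable {L : FirstOrder.Language.{0, 0}}

/-- A complete formula for `T` that holds of tuples in two models decides every formula in the
same way on both of them. -/
theorem IsCompleteFormula.realize_iff {T : L.Theory} {α : Type} {φ : L.Formula α}
    (hφ : IsCompleteFormula T φ) {M N : Type} [L.Structure M] [L.Structure N]
    [Nonempty M] [Nonempty N] (hM : M ⊨ T) (hN : N ⊨ T) {v : α → M} {w : α → N}
    (hv : φ.Realize v) (hw : φ.Realize w) (ψ : L.Formula α) :
    ψ.Realize v ↔ ψ.Realize w := by
  have transfer {χ : L.Formula α} (h : T ⊨ᵇ φ.imp χ) : χ.Realize v ∧ χ.Realize w :=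
    ⟨h (Theory.ModelType.of T M) v default hv, h (Theory.ModelType.of T N) w default hw⟩
  rcases hφ ψ with ⟨h, -⟩ | ⟨h, -⟩
  · exact iff_of_true (transfer h).1 (transfer h).2
  · exact iff_of_false (transfer h).1 (transfer h).2

/-- A sentence, presented as a formula in an empty set of variables, has the same truth value in
all models of a complete theory. -/
theorem FirstOrder.Language.Theory.IsComplete.realize_iff_of_isEmpty {T : L.Theory}
    (hT : T.IsComplete) {α : Type} [IsEmpty α] {M N : Type} [L.Structure M] [L.Structure N]
    [Nonempty M] [Nonempty N] (hM : M ⊨ T) (hN : N ⊨ T) (v : α → M) (w : α → N)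
    (φ : L.Formula α) : φ.Realize v ↔ φ.Realize w := by
  let σ : L.Sentence := φ.relabel (isEmptyElim : α → Empty)
  have hσM : M ⊨ σ ↔ φ.Realize v := by
    rw [Sentence.Realize, Formula.realize_relabel, Subsingleton.elim v]
  have hσN : N ⊨ σ ↔ φ.Realize w := by
    rw [Sentence.Realize, Formula.realize_relabel, Subsingleton.elim w]
  rw [← hσM, ← hσN]
  exact (hT.realize_sentence_iff σ M).trans (hT.realize_sentence_iff σ N).symm

/-- The formula `∃ y, φ(x₀, …, x_{n-1}, y)`. -/
noncomputable def existsLast {n : ℕ} (φ : L.Formula (Fin (n + 1))) : L.Formula (Fin n) :=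
  Formula.iExs Unit (φ.relabel (Fin.snoc (α := fun _ => Fin n ⊕ Unit) Sum.inl (Sum.inr ())))

theorem realize_existsLast {n : ℕ} {φ : L.Formula (Fin (n + 1))} {M : Type} [L.Structure M]
    {v : Fin n → M} :
    (existsLast φ).Realize v ↔ ∃ m, φ.Realize (Fin.snoc (α := fun _ => M) v m) := by
  have comp_snoc (i : Unit → M) :
      Sum.elim v i ∘ Fin.snoc (α := fun _ => Fin n ⊕ Unit) Sum.inl (Sum.inr ()) =
        Fin.snoc (α := fun _ => M) v (i ()) := by
    ext j
    refine Fin.lastCases ?_ (fun j => ?_) j <;> simp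
  simp only [existsLast, Formula.realize_iExs, Formula.realize_relabel, comp_snoc]
  exact ⟨fun ⟨i, h⟩ => ⟨_, h⟩, fun ⟨m, h⟩ => ⟨fun _ => m, h⟩⟩

/-- If every good tuple can be extended by an entry passing a computable test to a good tuple,
then some computable sequence has only good initial segments. -/
theorem exists_computable_forall_prefix {test : List ℕ → ℕ → Bool} (htest : Computable₂ test)
    {P : List ℕ → Prop} (nil : P []) (ex : ∀ l, P l → ∃ m, test l m = true)
    (step : ∀ l m, P l → test l m = true → P (l ++ [m])) :
    ∃ f : ℕ → ℕ, Computable f ∧ ∀ n, P ((List.range n).map f) := by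
  let next (l : List ℕ) : Part ℕ := Nat.rfind fun m => Part.some (test l m)
  have next_partrec : Partrec next := Partrec.rfind htest.partrec₂
  let F (n : ℕ) : Part (List ℕ) :=
    Nat.rec (Part.some []) (fun _ r => r.bind fun l => (next l).map fun m => l ++ [m]) n
  have F_partrec : Partrec F := by
    have extend : Partrec₂ fun (_ : ℕ) (p : ℕ × List ℕ) =>
        (next p.2).map fun m => p.2 ++ [m] := by
      refine Partrec.map (next_partrec.comp (Computable.snd.comp Computable.snd)) ?_
      exact Computable.list_append.comp
        (Computable.snd.comp (Computable.snd.comp Computable.fst))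
        (Computable.list_cons.comp Computable.snd (Computable.const []))
    exact Partrec.nat_rec Computable.id (Computable.const ([] : List ℕ)) extend
  have F_total (n : ℕ) : ∃ l, F n = Part.some l ∧ P l ∧ l.length = n := by
    induction n with
    | zero => exact ⟨[], rfl, nil, rfl⟩
    | succ n ih =>
      obtain ⟨l, hl, hP, hlen⟩ := ih
      obtain ⟨m, hm⟩ := ex l hP
      have hdom : (next l).Dom := Nat.rfind_dom.2 ⟨m, by simpa using hm, fun _ => trivial⟩
      obtain ⟨k, hk⟩ := Part.dom_iff_mem.1 hdom
      refine ⟨l ++ [k], ?_, step l k hP (by simpa using Nat.rfind_spec hk), by simp [hlen]⟩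
      change (F n).bind _ = _
      rw [hl, Part.bind_some, Part.eq_some_iff.2 hk, Part.map_some]
  choose s hs hP hlen using F_total
  have s_computable : Computable s := F_partrec.of_eq hs
  have s_succ (n : ℕ) : ∃ m, s (n + 1) = s n ++ [m] := by
    have h : Part.some (s (n + 1)) = (F n).bind fun l => (next l).map fun m => l ++ [m] :=
      (hs (n + 1)).symm
    rw [hs n, Part.bind_some] at h
    obtain ⟨m, -, hm⟩ := (Part.mem_map_iff _).1 (h ▸ Part.mem_some (s (n + 1)))
    exact ⟨m, hm.symm⟩
  refine ⟨fun n => (s (n + 1)).getD n 0, ?_, fun n => ?_⟩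
  · exact (Primrec.list_getD 0).to_comp.comp (s_computable.comp Computable.succ) Computable.id
  · suffices h : (List.range n).map (fun i => (s (i + 1)).getD i 0) = s n from h ▸ hP n
    induction n with
    | zero => exact (List.length_eq_zero_iff.1 (hlen 0)).symm
    | succ n ih =>
      obtain ⟨m, hm⟩ := s_succ n
      rw [List.range_succ, List.map_append, ih, List.map_singleton, hm]
      simp [List.getD_eq_getElem?_getD, hlen n]

variable [∀ k, Encodable (L.Functions k)] [∀ k, Encodable (L.Relations k)]

/-- An effectively atomic structure has a uniformly computable family of complete formulas for its
initial segments `0, …, n-1`. -/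
theorem IsEffectivelyAtomic.exists_computable_formulas {T : L.Theory} {S : L.Structure ℕ}
    (h : IsEffectivelyAtomic T S) :
    ∃ φ : ∀ n, L.Formula (Fin n), Computable (fun n => fmlCode (φ n)) ∧
      ∀ n, IsCompleteFormula T (φ n) ∧ (φ n).Realize (fun i : Fin n => (i : ℕ)) := by
  obtain ⟨g, hg, hgs⟩ := h
  have key (n : ℕ) : ∃ φ : L.Formula (Fin n), g (Encodable.encode (List.range n)) = fmlCode φ ∧
      IsCompleteFormula T φ ∧ φ.Realize (fun i : Fin n => (i : ℕ)) := by
    suffices H : ∀ (l : List ℕ) (hl : l.length = n), ∃ φ : L.Formula (Fin n),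
        g (Encodable.encode l) = fmlCode φ ∧ IsCompleteFormula T φ ∧
          φ.Realize (fun i : Fin n => l.get (i.cast hl.symm)) by
      simpa using H (List.range n) List.length_range
    rintro l rfl
    exact hgs l
  choose φ hφ using key
  refine ⟨φ, ?_, fun n => (hφ n).2⟩
  exact (hg.comp (Computable.encode.comp Primrec.list_range.to_comp)).of_eq fun n => (hφ n).1

end Effective

/-- (Effectively Atomic ⇒ Effectively Prime) A decidable, effectively atomic model of a
complete, decidable theory `T` is effectively prime. -/
theorem effectively_atomic_implies_effectively_prime {L : FirstOrder.Language.{0, 0}}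
    [∀ k, Encodable (L.Functions k)] [∀ k, Encodable (L.Relations k)]
    (T : L.Theory) (hT : T.IsComplete) (hTdec : IsDecidableTheory T)
    (SA : L.Structure ℕ) (hSAdec : IsDecidableStructure SA)
    (hSAmod : StructureModels SA T) (hSAatomic : IsEffectivelyAtomic T SA) :
    IsEffectivelyPrime T SA := by
  intro SM hSMdec hSMmod
  obtain ⟨φ, hφ, hφc⟩ := hSAatomic.exists_computable_formulas
  obtain ⟨d, hd, hds⟩ := hSMdec
  have realizes_iff {n : ℕ} (b : Fin n → ℕ) (c : Fin n → ℕ)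
      (hb : @Formula.Realize L ℕ SM _ (φ n) b) (hc : @Formula.Realize L ℕ SA _ (φ n) c)
      (ψ : L.Formula (Fin n)) :
      @Formula.Realize L ℕ SM _ ψ b ↔ @Formula.Realize L ℕ SA _ ψ c :=
    @IsCompleteFormula.realize_iff L T _ _ (hφc n).1 ℕ ℕ SM SA _ _ hSMmod hSAmod _ _ hb hc ψ
  let P (l : List ℕ) : Prop :=
    ∃ (n : ℕ) (b : Fin n → ℕ), l = List.ofFn b ∧ @Formula.Realize L ℕ SM _ (φ n) b
  have ofFn_snoc {n : ℕ} (b : Fin n → ℕ) (m : ℕ) :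
      List.ofFn b ++ [m] = List.ofFn (Fin.snoc (α := fun _ => ℕ) b m) := by
    rw [List.ofFn_succ_last]
    simp
  have : ∃ f : ℕ → ℕ, Computable f ∧ ∀ n, P ((List.range n).map f) := by
    refine exists_computable_forall_prefix (P := P)
      (test := fun l m => d (fmlCode (φ (l.length + 1))) (Encodable.encode (l ++ [m]))) ?_ ?_ ?_ ?_
    · refine hd.comp₂ ?_ ?_
      · exact hφ.comp (Computable.succ.comp (Computable.list_length.comp Computable.fst))
      · exact Computable.encode.comp (Computable.list_append.comp Computable.fst
          (Computable.list_cons.comp Computable.snd (Computable.const [])))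
    · refine ⟨0, Fin.elim0, rfl, ?_⟩
      exact (@Theory.IsComplete.realize_iff_of_isEmpty L T hT _ _ ℕ ℕ SM SA _ _ hSMmod hSAmod
        _ _ (φ 0)).2 (hφc 0).2
    · rintro _ ⟨n, b, rfl, hb⟩
      have hA : @Formula.Realize L ℕ SA _ (existsLast (φ (n + 1))) (fun i : Fin n => (i : ℕ)) := by
        refine (@realize_existsLast L n _ ℕ SA _).2 ⟨n, ?_⟩
        convert (hφc (n + 1)).2 using 1
        ext j
        refine Fin.lastCases ?_ (fun j => ?_) j <;> simp
      obtain ⟨m, hm⟩ := (@realize_existsLast L n _ ℕ SM _).1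
        ((realizes_iff b _ hb (hφc n).2 _).2 hA)
      refine ⟨m, ?_⟩
      rw [ofFn_snoc, List.length_ofFn]
      exact (hds _ _ _).2 hm
    · rintro _ m ⟨n, b, rfl, hb⟩ h
      rw [ofFn_snoc, List.length_ofFn] at h
      exact ⟨n + 1, _, ofFn_snoc b m, (hds _ _ _).1 h⟩
  obtain ⟨f, hf, hfP⟩ := this
  refine ⟨f, hf, fun n ψ a => ?_⟩
  let N := Finset.univ.sup a + 1
  let a' (i : Fin n) : Fin N :=
    ⟨a i, Nat.lt_succ_of_le (Finset.le_sup (f := a) (Finset.mem_univ i))⟩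
  have hN : @Formula.Realize L ℕ SM _ (φ N) (fun i => f i) := by
    obtain ⟨k, b, hb, hbφ⟩ := hfP N
    obtain rfl : N = k := by simpa using congrArg List.length hb
    have hbf : b = fun i : Fin N => f i := by
      refine List.ofFn_injective (hb.symm.trans ?_)
      rw [List.ofFn_eq_map, ← List.map_coe_finRange_eq_range, List.map_map]
      rfl
    rwa [← hbf]
  have := realizes_iff _ _ hN (hφc N).2 (ψ.relabel a')
  rw [@Formula.realize_relabel _ _ SM, @Formula.realize_relabel _ _ SA] at this
  exact this
end
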